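/- Let b > 0 and let f : ℝ → ℝ be the mean-zero Laplace density f(x) = (1/(2b))·exp(−|x|/b). Then for every permutation π of {1,…,n+1}, P(f,π) = 1/(2^n · ∏_{j=1}^n lev(π)_j). -/

import Mathlib

open MeasureTheory

noncomputable section

/-- Walk positions: `walk n x i = x 0 + ⋯ + x (i-1)` (so `walk n x 0 = 0`). -/
def walk (n : ℕ) (x : Fin n → ℝ) (i : Fin (n + 1)) : ℝ :=
  ∑ j : Fin n, if (j : ℕ) < (i : ℕ) then x j else 0

/-- The region of step tuples generating the ordinal pattern `π`. -/
def D (n : ℕ) (π : Equiv.Perm (Fin (n + 1))) : Set (Fin n → ℝ) :=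
  {x | (∀ i j : Fin (n + 1), i ≠ j → walk n x i ≠ walk n x j) ∧
       (∀ i j : Fin (n + 1), walk n x i < walk n x j ↔ π i < π j)}

/-- The matrix `L_π`. -/
def L (n : ℕ) (π : Equiv.Perm (Fin (n + 1))) : Matrix (Fin n) (Fin n) ℝ :=
  fun i j =>
    if (π i.castSucc : ℕ) ≤ (j : ℕ) ∧ (j : ℕ) < (π i.succ : ℕ) then 1
    else if (π i.succ : ℕ) ≤ (j : ℕ) ∧ (j : ℕ) < (π i.castSucc : ℕ) then -1
    else 0

/-- Partial sum `x i + x (i+1) + ⋯ + x (j-1)`. -/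
def psum (n : ℕ) (x : Fin n → ℝ) (i j : Fin (n + 1)) : ℝ :=
  ∑ k : Fin n, if (i : ℕ) ≤ (k : ℕ) ∧ (k : ℕ) < (j : ℕ) then x k else 0

/-- The level count `lev(π)_j`. -/
def lev (n : ℕ) (π : Equiv.Perm (Fin (n + 1))) (j : Fin n) : ℕ :=
  (Finset.univ.filter fun i : Fin n =>
    ((π i.castSucc : ℕ) ≤ (j : ℕ) ∧ (j : ℕ) < (π i.succ : ℕ)) ∨
    ((π i.succ : ℕ) ≤ (j : ℕ) ∧ (j : ℕ) < (π i.castSucc : ℕ))).card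

/-- The polytope of steps `P_π`. -/
def Ppoly (n : ℕ) (π : Equiv.Perm (Fin (n + 1))) : Set (Fin n → ℝ) :=
  {x | (∀ i, 0 ≤ x i) ∧ ∀ i : Fin n,
    psum n x (min (π i.castSucc) (π i.succ)) (max (π i.castSucc) (π i.succ)) ≤ 1}

/-- The set of positive roots, identified with pairs `i < j`. -/
def PosRoot (n : ℕ) := {p : Fin (n + 1) × Fin (n + 1) // p.1 < p.2}

/-- The Shi condition for an alcove address. -/
def Shi (n : ℕ) (k : PosRoot n → ℤ) : Prop :=
  ∀ (i t j : Fin (n + 1)) (hit : i < t) (htj : t < j),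
    k ⟨(i, t), hit⟩ + k ⟨(t, j), htj⟩ ≤ k ⟨(i, j), hit.trans htj⟩ ∧
    k ⟨(i, j), hit.trans htj⟩ ≤ k ⟨(i, t), hit⟩ + k ⟨(t, j), htj⟩ + 1

/-- The alcove with address `k`, in step coordinates. -/
def alcove (n : ℕ) (k : PosRoot n → ℤ) : Set (Fin n → ℝ) :=
  {x | ∀ p : PosRoot n,
    (k p : ℝ) < psum n x p.1.1 p.1.2 ∧ psum n x p.1.1 p.1.2 < (k p : ℝ) + 1}

/-- The root ideal `I_π`. -/
def rootIdeal (n : ℕ) (π : Equiv.Perm (Fin (n + 1))) : Set (PosRoot n) :=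
  {p | ∃ c : Fin n,
    min (π c.castSucc : ℕ) (π c.succ : ℕ) ≤ (p.1.1 : ℕ) ∧
    (p.1.2 : ℕ) ≤ max (π c.castSucc : ℕ) (π c.succ : ℕ)}

/-- The level count matrix `lev(π)_{i,j}`. -/
def lev2 (n : ℕ) (π : Equiv.Perm (Fin (n + 1))) (i j : Fin n) : ℕ :=
  (Finset.univ.filter fun k : Fin n =>
    ((π k.castSucc : ℕ) ≤ (i : ℕ) ∧ (π k.castSucc : ℕ) ≤ (j : ℕ) ∧
     (i : ℕ) < (π k.succ : ℕ) ∧ (j : ℕ) < (π k.succ : ℕ)) ∨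
    ((π k.succ : ℕ) ≤ (i : ℕ) ∧ (π k.succ : ℕ) ≤ (j : ℕ) ∧
     (i : ℕ) < (π k.castSucc : ℕ) ∧ (j : ℕ) < (π k.castSucc : ℕ))).card

theorem L_mulVec (n : ℕ) (π : Equiv.Perm (Fin (n + 1))) (y : Fin n → ℝ) (i : Fin n) :
    (L n π).mulVec y i = walk n y (π i.succ) - walk n y (π i.castSucc) := by
  simp only [Matrix.mulVec, dotProduct, L, walk, ← Finset.sum_sub_distrib]
  refine Finset.sum_congr rfl fun j _ => ?_
  split_ifs <;> first | omega | simp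

theorem walk_zero (n : ℕ) (x : Fin n → ℝ) : walk n x 0 = 0 := by
  simp [walk]

theorem walk_succ (n : ℕ) (x : Fin n → ℝ) (i : Fin n) :
    walk n x i.succ = walk n x i.castSucc + x i := by
  have h : x i = ∑ j : Fin n, if j = i then x j else 0 := by simp
  rw [h]
  simp only [walk, ← Finset.sum_add_distrib]
  refine Finset.sum_congr rfl fun j _ => ?_
  simp only [Fin.val_succ, Fin.val_castSucc, Fin.ext_iff]
  split_ifs <;> first | omega | simp

theorem walk_L_mulVec (n : ℕ) (π : Equiv.Perm (Fin (n + 1))) (y : Fin n → ℝ)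
    (i : Fin (n + 1)) :
    walk n ((L n π).mulVec y) i = walk n y (π i) - walk n y (π 0) := by
  induction i using Fin.induction with
  | zero => simp [walk_zero]
  | succ i ih => rw [walk_succ, ih, L_mulVec]; ring

theorem L_mul_L_symm (n : ℕ) (π : Equiv.Perm (Fin (n + 1))) :
    L n π * L n π.symm = 1 := by
  apply Matrix.toLin'.injective
  refine LinearMap.ext fun y => funext fun i => ?_
  rw [Matrix.toLin'_mul, LinearMap.comp_apply, Matrix.toLin'_apply, Matrix.toLin'_apply,
    L_mulVec, walk_L_mulVec, walk_L_mulVec, Equiv.symm_apply_apply, Equiv.symm_apply_apply,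
    walk_succ]
  simp

theorem exists_int_det_L (n : ℕ) (π : Equiv.Perm (Fin (n + 1))) :
    ∃ d : ℤ, (L n π).det = d := by
  choose A hA using fun i j => show ∃ a : ℤ, (a : ℝ) = L n π i j by
    unfold L
    split_ifs
    exacts [⟨1, by simp⟩, ⟨-1, by simp⟩, ⟨0, by simp⟩]
  refine ⟨(Matrix.of A).det, ?_⟩
  rw [Int.cast_det]
  congr 1
  ext i j
  simp [hA]

theorem abs_det_L (n : ℕ) (π : Equiv.Perm (Fin (n + 1))) : |(L n π).det| = 1 := by
  obtain ⟨d, hd⟩ := exists_int_det_L n π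
  obtain ⟨e, he⟩ := exists_int_det_L n π.symm
  have h := congrArg Matrix.det (L_mul_L_symm n π)
  rw [Matrix.det_mul, Matrix.det_one, hd, he] at h
  have hde : d * e = 1 := by exact_mod_cast h
  rw [hd]
  exact_mod_cast Int.isUnit_iff_abs_eq.mp (IsUnit.of_mul_eq_one _ hde)

theorem lev_eq_sum_abs_L (n : ℕ) (π : Equiv.Perm (Fin (n + 1))) (j : Fin n) :
    (lev n π j : ℝ) = ∑ i, |L n π i j| := by
  rw [lev, Finset.card_filter, Nat.cast_sum]
  refine Finset.sum_congr rfl fun i _ => ?_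
  unfold L
  split_ifs <;> first | omega | simp

theorem lev_pos (n : ℕ) (π : Equiv.Perm (Fin (n + 1))) (j : Fin n) :
    (0 : ℝ) < lev n π j := by
  rw [lev_eq_sum_abs_L]
  refine (Finset.sum_nonneg fun i _ => abs_nonneg _).lt_of_ne' fun h => ?_
  have hcol : (L n π).det = 0 := Matrix.det_eq_zero_of_column_eq_zero j fun i =>
    abs_eq_zero.mp ((Finset.sum_eq_zero_iff_of_nonneg fun i _ => abs_nonneg _).mp h i
      (Finset.mem_univ i))
  simpa [hcol] using abs_det_L n π

theorem abs_L_mulVec (n : ℕ) (π : Equiv.Perm (Fin (n + 1))) {y : Fin n → ℝ}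
    (hy : ∀ j, 0 < y j) (i : Fin n) :
    |(L n π).mulVec y i| = ∑ j, |L n π i j| * y j := by
  have habs : ∀ j, |L n π i j| * y j = |L n π i j * y j| := fun j => by
    rw [abs_mul, abs_of_pos (hy j)]
  simp only [habs, Matrix.mulVec, dotProduct]
  rcases le_total (π i.castSucc) (π i.succ) with h | h
  · have hnn : ∀ j, 0 ≤ L n π i j * y j := fun j => by
      refine mul_nonneg ?_ (hy j).le
      rw [Fin.le_def] at h
      unfold L
      split_ifs <;> first | omega | simp
    rw [abs_of_nonneg (Finset.sum_nonneg fun j _ => hnn j)]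
    exact Finset.sum_congr rfl fun j _ => (abs_of_nonneg (hnn j)).symm
  · have hnp : ∀ j, L n π i j * y j ≤ 0 := fun j => by
      refine mul_nonpos_of_nonpos_of_nonneg ?_ (hy j).le
      rw [Fin.le_def] at h
      unfold L
      split_ifs <;> first | omega | simp
    rw [abs_of_nonpos (Finset.sum_nonpos fun j _ => hnp j), ← Finset.sum_neg_distrib]
    exact Finset.sum_congr rfl fun j _ => (abs_of_nonpos (hnp j)).symm

theorem strictMono_walk_iff (n : ℕ) (y : Fin n → ℝ) :
    StrictMono (walk n y) ↔ ∀ j, 0 < y j := by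
  simp [Fin.strictMono_iff_lt_succ, walk_succ]

theorem L_mulVec_mem_D_iff (n : ℕ) (π : Equiv.Perm (Fin (n + 1))) (y : Fin n → ℝ) :
    (L n π).mulVec y ∈ D n π ↔ ∀ j, 0 < y j := by
  rw [← strictMono_walk_iff]
  simp only [D, Set.mem_ofPred_eq, walk_L_mulVec, sub_lt_sub_iff_right, ne_eq, sub_left_inj]
  constructor
  · rintro ⟨-, h⟩ a b hab
    simpa using (h (π.symm a) (π.symm b)).2 (by simpa using hab)
  · exact fun h => ⟨fun i j hij heq => hij (π.injective (h.injective heq)),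
      fun i j => h.lt_iff_lt⟩

theorem measurePreserving_L (n : ℕ) (π : Equiv.Perm (Fin (n + 1))) :
    MeasurePreserving (Matrix.toLin' (L n π)) := by
  have hdet : (L n π).det ≠ 0 := fun h => by simpa [h] using abs_det_L n π
  refine ⟨(LinearMap.continuous_of_finiteDimensional _).measurable, ?_⟩
  rw [Real.map_matrix_volume_pi_eq_smul_volume_pi hdet, abs_inv, abs_det_L]
  simp

theorem measurableEmbedding_L (n : ℕ) (π : Equiv.Perm (Fin (n + 1))) :
    MeasurableEmbedding (Matrix.toLin' (L n π)) := by
  refine (LinearMap.continuous_of_finiteDimensional _).measurableEmbedding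
    (Function.LeftInverse.injective (g := Matrix.toLin' (L n π.symm)) fun y => ?_)
  have h := L_mul_L_symm n π.symm
  rw [Equiv.symm_symm] at h
  rw [← LinearMap.comp_apply, ← Matrix.toLin'_mul, h, Matrix.toLin'_one, LinearMap.id_apply]

theorem prod_laplace_L_mulVec (n : ℕ) (π : Equiv.Perm (Fin (n + 1))) (b : ℝ)
    {y : Fin n → ℝ} (hy : ∀ j, 0 < y j) :
    ∏ i : Fin n, (1 / (2 * b)) * Real.exp (-|(L n π).mulVec y i| / b) =
      ∏ j : Fin n, (1 / (2 * b)) * Real.exp (-(lev n π j / b) * y j) := by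
  rw [Finset.prod_mul_distrib, Finset.prod_mul_distrib, ← Real.exp_sum, ← Real.exp_sum]
  congr 2
  simp only [abs_L_mulVec n π hy, lev_eq_sum_abs_L, neg_div, Finset.sum_neg_distrib, neg_mul,
    Finset.sum_div, Finset.sum_mul]
  rw [Finset.sum_comm]
  exact congrArg _ (Finset.sum_congr rfl fun j _ => Finset.sum_congr rfl fun i _ => by ring)

/-- for the mean-zero Laplace density,
`P(f,π) = 1/(2^n ∏_j lev(π)_j)`. -/
theorem stmt_6 (n : ℕ) (hn : 1 ≤ n) (b : ℝ) (hb : 0 < b)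
    (π : Equiv.Perm (Fin (n + 1))) :
    ∫ x in D n π, ∏ i : Fin n, (1 / (2 * b)) * Real.exp (-|x i| / b) =
    1 / (2 ^ n * ∏ j : Fin n, (lev n π j : ℝ)) := by
  have hpre : Matrix.toLin' (L n π) ⁻¹' D n π = Set.univ.pi fun _ => Set.Ioi 0 := by
    ext y
    simp [Matrix.toLin'_apply, L_mulVec_mem_D_iff]
  have hprod : Set.EqOn
      (fun y => ∏ i, (1 / (2 * b)) * Real.exp (-|Matrix.toLin' (L n π) y i| / b))
      (fun y => ∏ j, (1 / (2 * b)) * Real.exp (-(lev n π j / b) * y j))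
      (Set.univ.pi fun _ => Set.Ioi 0) :=
    fun y hy => prod_laplace_L_mulVec n π b fun j => hy j (Set.mem_univ j)
  rw [← (measurePreserving_L n π).setIntegral_preimage_emb (measurableEmbedding_L n π), hpre,
    setIntegral_congr_fun (MeasurableSet.univ_pi fun _ => measurableSet_Ioi) hprod,
    volume_pi, Measure.restrict_pi_pi,
    integral_fintype_prod_eq_prod (𝕜 := ℝ)
      (fun j t => (1 / (2 * b)) * Real.exp (-(lev n π j / b) * t))]
  have hint : ∀ j, ∫ t in Set.Ioi (0 : ℝ), (1 / (2 * b)) * Real.exp (-(lev n π j / b) * t) =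
      (2 * (lev n π j : ℝ))⁻¹ := fun j => by
    have hl := lev_pos n π j
    rw [integral_const_mul, integral_exp_mul_Ioi (neg_neg_of_pos (div_pos hl hb))]
    simp only [mul_zero, Real.exp_zero]
    field_simp
  rw [Finset.prod_congr rfl fun j _ => hint j, Finset.prod_inv_distrib, Finset.prod_mul_distrib,
    Finset.prod_const, Finset.card_univ, Fintype.card_fin, one_div]
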